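/- arXiv:0709.1914 — 2 statements merged into one kernel-verified Lean document; each statement's English description precedes it below -/
import Mathlib

section
/- Let α be an irrational number NOT satisfying any Diophantine condition (α ∉ CD, i.e., for all c>0 and τ≥0 there exists an integer N≥1 with ‖Nα‖ < c/N^{1+τ}). Then there exists a C^∞ function φ : 𝕋¹ → ℂ with zero mean such that no C^∞ function ψ : 𝕋¹ → ℂ satisfies the cohomological equation ψ(θ+α) − ψ(θ) = φ(θ) for all θ ∈ 𝕋¹. -/
open MeasureTheory Metric Complex Real Set Function

noncomputable section

/-- Distance from a real number to the nearest integer. -/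
def distInt (x : ℝ) : ℝ := ⨅ p : ℤ, |x - (p : ℝ)|

/-- The Diophantine condition CD on a real number. -/
def IsCD (α : ℝ) : Prop :=
  Irrational α ∧ ∃ c : ℝ, 0 < c ∧ ∃ τ : ℝ, 0 ≤ τ ∧
    ∀ N : ℕ, 1 ≤ N → c / (N : ℝ) ^ (1 + τ) ≤ distInt (N * α)

/-- The Diophantine condition CD₁ on a pair of real numbers. -/
def IsCD1 (α β : ℝ) : Prop :=
  Irrational α ∧ ∃ c : ℝ, 0 < c ∧ ∃ τ : ℝ, 0 ≤ τ ∧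
    (∀ N : ℕ, 1 ≤ N → c / (N : ℝ) ^ (1 + τ) ≤ distInt (N * α)) ∧
    (∀ N : ℤ, N ≠ 0 → c / |(N : ℝ)| ^ (1 + τ) ≤ distInt (N * α - β))

/-- The C^r norm of a smooth Banach-space-valued function on the circle. -/
def cNorm {E : Type*} [NormedAddCommGroup E] [NormedSpace ℝ E] (r : ℕ) (g : ℝ → E) : ℝ :=
  ∑ i ∈ Finset.range (r + 1), ⨆ θ : ℝ, ‖iteratedDeriv i g θ‖

/-- C^∞ and ℤ-periodic : a smooth function on the circle 𝕋¹ = ℝ/ℤ. -/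
def SmoothPer {E : Type*} [NormedAddCommGroup E] [NormedSpace ℝ E] (g : ℝ → E) : Prop :=
  ContDiff ℝ (⊤ : ℕ∞) g ∧ Function.Periodic g 1

/-- Fourier coefficients of a function on the circle. -/
def fourierCoef (φ : ℝ → ℂ) (n : ℤ) : ℂ :=
  ∫ θ in (0:ℝ)..1, φ θ * Complex.exp (-(2 * π * I * n * θ))

/-- The closed disc of radius r in ℂ. -/
abbrev OmDom (r : ℝ) : Set ℂ := Metric.closedBall (0 : ℂ) r

instance (r : ℝ) : CompactSpace (OmDom r) :=
  isCompact_iff_compactSpace.mp (isCompact_closedBall (0:ℂ) r)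

/-- The Banach space Ω(closure D(0,r)) realized as continuous functions on the closed disc
(holomorphy on the open disc is the predicate `HolOm`), with the sup norm. -/
abbrev Om (r : ℝ) := C(OmDom r, ℂ)

-- Evaluation of an element of Ω at a point of the closed disc (junk value outside).
open scoped Classical in
def evOm {r : ℝ} (g : Om r) (z : ℂ) : ℂ :=
  if h : z ∈ OmDom r then g ⟨z, h⟩ else 0

/-- Holomorphy on the open disc. -/
def HolOm {r : ℝ} (g : Om r) : Prop :=
  DifferentiableOn ℂ (evOm g) (Metric.ball (0:ℂ) r)

/-- The model fiber map z ↦ e^{2πiβ} z as an element of Ω(closure 𝔻). -/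
def lamMap (β : ℝ) : Om 1 :=
  ⟨fun z => Complex.exp (2 * π * I * β) * z.val, by fun_prop⟩

/-- `u` is a C^∞ curve with values in the open unit disc, invariant under the fibered
holomorphic dynamics F(θ,z) = (θ+α, f(θ,z)). -/
def IsInvCurve (α : ℝ) (f : ℝ → Om 1) (u : ℝ → ℂ) : Prop :=
  ContDiff ℝ (⊤ : ℕ∞) u ∧ Function.Periodic u 1 ∧ (∀ θ, ‖u θ‖ < 1) ∧
    ∀ θ, evOm (f θ) (u θ) = u (θ + α)

/-- The curve `u` has degree zero (the derivative along the curve admits a continuous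
logarithm ℓ on 𝕋¹), is indifferent (∫ log|∂_z f(θ,u(θ))| dθ = 0), and its transversal
rotation number (1/2πi)∫ ℓ is β mod 1. -/
def HasRotNum (β : ℝ) (f : ℝ → Om 1) (u : ℝ → ℂ) : Prop :=
  ∃ ℓ : ℝ → ℂ, Continuous ℓ ∧ Function.Periodic ℓ 1 ∧
    (∀ θ, Complex.exp (ℓ θ) = deriv (evOm (f θ)) (u θ)) ∧
    (∫ θ in (0:ℝ)..1, (ℓ θ).re) = 0 ∧
    ∃ m : ℤ, (∫ θ in (0:ℝ)..1, ℓ θ) = 2 * π * I * (β + m)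

/-- Smallest singular value of an ℝ-linear map ℂ → ℂ (ℂ ≅ ℝ²). -/
def minSv (A : ℂ →L[ℝ] ℂ) : ℝ := ⨅ v : Metric.sphere (0:ℂ) 1, ‖A v.val‖

end

theorem distInt_eq_abs_sub_round (x : ℝ) : distInt x = |x - round x| :=
  le_antisymm (ciInf_le ⟨0, by rintro _ ⟨p, rfl⟩; positivity⟩ _) (le_ciInf fun p => round_le x p)

theorem distInt_natCast_mul_pos {α : ℝ} (hirr : Irrational α) {n : ℕ} (hn : 1 ≤ n) :
    0 < distInt (n * α) := by
  rw [distInt_eq_abs_sub_round, abs_pos, sub_ne_zero]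
  exact (hirr.natCast_mul (by omega)).ne_int _

/-- An irrational number satisfying no Diophantine condition has arbitrarily large
denominators violating any given one. -/
theorem frequently_distInt_lt {α : ℝ} (hirr : Irrational α)
    (hα : ∀ c : ℝ, 0 < c → ∀ τ : ℝ, 0 ≤ τ →
      ∃ N : ℕ, 1 ≤ N ∧ distInt (N * α) < c / (N : ℝ) ^ (1 + τ)) {τ : ℝ} (hτ : 0 ≤ τ) :
    ∃ᶠ N : ℕ in Filter.atTop, 1 ≤ N ∧ distInt (N * α) < 1 / (N : ℝ) ^ (1 + τ) := by
  rw [Filter.frequently_atTop]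
  intro M
  obtain ⟨c, hc, hc1, hcM⟩ : ∃ c : ℝ, 0 < c ∧ c ≤ 1 ∧
      ∀ n : ℕ, 1 ≤ n → n < M → c ≤ distInt (n * α) := by
    induction M with
    | zero => exact ⟨1, one_pos, le_rfl, by simp⟩
    | succ M ih =>
      obtain ⟨c, hc, hc1, hcM⟩ := ih
      rcases Nat.eq_zero_or_pos M with rfl | hM
      · exact ⟨c, hc, hc1, fun n h1 h2 => by omega⟩
      refine ⟨min c (distInt (M * α)), lt_min hc (distInt_natCast_mul_pos hirr hM),
        (min_le_left _ _).trans hc1, fun n h1 h2 => ?_⟩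
      rcases Nat.lt_succ_iff_lt_or_eq.mp h2 with h | rfl
      · exact (min_le_left _ _).trans (hcM n h1 h)
      · exact min_le_right _ _
  obtain ⟨N, hN, hlt⟩ := hα c hc τ hτ
  have hN1 : (1 : ℝ) ≤ (N : ℝ) := by exact_mod_cast hN
  refine ⟨N, ?_, hN, hlt.trans_le (by gcongr)⟩
  by_contra! h
  exact absurd (hlt.trans_le (div_le_self hc.le (Real.one_le_rpow hN1 (by linarith))))
    (not_lt.mpr (hcM N hN h))

/-- The character `θ ↦ e^{2πinθ}` of the circle. -/
noncomputable def circleMode (n : ℤ) (θ : ℝ) : ℂ := Complex.exp (2 * π * I * n * θ)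

theorem norm_circleMode (n : ℤ) (θ : ℝ) : ‖circleMode n θ‖ = 1 := by
  have : (2 * π * I * n * θ : ℂ) = ((2 * π * n * θ : ℝ) : ℂ) * I := by push_cast; ring
  rw [circleMode, this, Complex.norm_exp_ofReal_mul_I]

theorem contDiff_circleMode (n : ℤ) {r : WithTop ℕ∞} : ContDiff ℝ r (circleMode n) := by
  unfold circleMode
  have : ContDiff ℝ r (fun x : ℝ => (x : ℂ)) := Complex.ofRealCLM.contDiff
  fun_prop

theorem continuous_circleMode (n : ℤ) : Continuous (circleMode n) :=
  (contDiff_circleMode n (r := 0)).continuous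

theorem circleMode_periodic (n : ℤ) : Function.Periodic (circleMode n) 1 := by
  intro θ
  rw [circleMode, circleMode, Complex.exp_eq_exp_iff_exists_int]
  exact ⟨n, by push_cast; ring⟩

theorem circleMode_eq_one_iff (n : ℤ) (θ : ℝ) : circleMode n θ = 1 ↔ ∃ m : ℤ, n * θ = m := by
  rw [circleMode, Complex.exp_eq_one_iff]
  refine exists_congr fun m => ?_
  have hpi : (2 * π * I : ℂ) ≠ 0 := Complex.two_pi_I_ne_zero
  rw [show (2 * π * I * n * θ : ℂ) = (n * θ) * (2 * π * I) by ring, mul_left_inj' hpi]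
  norm_cast

theorem norm_circleMode_sub_one_le (n : ℤ) (θ : ℝ) :
    ‖circleMode n θ - 1‖ ≤ 2 * π * distInt (n * θ) := by
  have h : circleMode n θ =
      Complex.exp (I * ((2 * π * (n * θ - round (n * θ)) : ℝ) : ℂ)) := by
    rw [circleMode, Complex.exp_eq_exp_iff_exists_int]
    exact ⟨round (n * θ), by push_cast; ring⟩
  rw [h, distInt_eq_abs_sub_round]
  refine Real.norm_exp_I_mul_ofReal_sub_one_le.trans_eq ?_
  rw [Real.norm_eq_abs, abs_mul, abs_of_pos Real.two_pi_pos]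

theorem iteratedDeriv_circleMode (r : ℕ) (n : ℤ) :
    iteratedDeriv r (circleMode n) = fun θ => (2 * π * I * n) ^ r * circleMode n θ := by
  induction r with
  | zero => simp
  | succ r ih =>
    rw [iteratedDeriv_succ, ih]
    funext θ
    have h : HasDerivAt (circleMode n) (circleMode n θ * (2 * π * I * n * 1)) θ :=
      ((Complex.ofRealCLM.hasDerivAt (x := θ)).const_mul (2 * π * I * n : ℂ)).cexp
    rw [(h.const_mul _).deriv]
    ring

theorem norm_iteratedFDeriv_const_mul_circleMode (r : ℕ) (n : ℤ) (a : ℂ) (θ : ℝ) :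
    ‖iteratedFDeriv ℝ r (fun θ => a * circleMode n θ) θ‖ = ‖a‖ * (2 * π * |(n : ℝ)|) ^ r := by
  rw [norm_iteratedFDeriv_eq_norm_iteratedDeriv,
    iteratedDeriv_const_mul _ (contDiff_circleMode n).contDiffAt, iteratedDeriv_circleMode]
  simp [norm_circleMode, abs_of_pos Real.pi_pos]

theorem smoothPer_tsum_circleMode {N : ℕ → ℤ} {a : ℕ → ℂ}
    (h : ∀ r : ℕ, Summable fun k => ‖a k‖ * (2 * π * |(N k : ℝ)|) ^ r) :
    SmoothPer fun θ => ∑' k, a k * circleMode (N k) θ := by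
  refine ⟨contDiff_tsum (fun k => contDiff_const.mul (contDiff_circleMode _))
    (fun r _ => h r)
    fun r k θ _ => (norm_iteratedFDeriv_const_mul_circleMode r (N k) (a k) θ).le, fun θ => ?_⟩
  simp only [circleMode_periodic _ θ]

theorem fourierCoef_eq (φ : ℝ → ℂ) (n : ℤ) :
    fourierCoef φ n = ∫ θ in (0:ℝ)..1, φ θ * circleMode (-n) θ := by
  unfold fourierCoef circleMode
  congr! 4
  push_cast
  ring

theorem circleMode_mul (m n : ℤ) (θ : ℝ) :
    circleMode m θ * circleMode n θ = circleMode (m + n) θ := by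
  rw [circleMode, circleMode, circleMode, ← Complex.exp_add]
  push_cast
  ring_nf

theorem integral_circleMode (n : ℤ) :
    ∫ θ in (0:ℝ)..1, circleMode n θ = if n = 0 then 1 else 0 := by
  split_ifs with hn
  · simp [circleMode, hn]
  · have hc : (2 * π * I * n : ℂ) ≠ 0 :=
      mul_ne_zero Complex.two_pi_I_ne_zero (Int.cast_ne_zero.mpr hn)
    unfold circleMode
    rw [integral_exp_mul_complex hc]
    have h : Complex.exp (2 * π * I * n * (1 : ℝ)) = 1 :=
      (circleMode_eq_one_iff n 1).mpr ⟨n, mul_one _⟩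
    rw [h]
    simp

theorem fourierCoef_tsum_circleMode {N : ℕ → ℤ} {a : ℕ → ℂ}
    (h : Summable fun k => ‖a k‖) (n : ℤ) :
    fourierCoef (fun θ => ∑' k, a k * circleMode (N k) θ) n =
      ∑' k, if N k = n then a k else 0 := by
  have hs : HasSum (fun k => ∫ θ in (0:ℝ)..1, a k * circleMode (N k) θ * circleMode (-n) θ)
      (∫ θ in (0:ℝ)..1, (∑' k, a k * circleMode (N k) θ) * circleMode (-n) θ) := by
    refine intervalIntegral.hasSum_integral_of_dominated_convergence (fun k _ => ‖a k‖)
      (fun k => ?_) (fun k => ?_) ?_ ?_ ?_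
    · exact ((continuous_const.mul (continuous_circleMode _)).mul
        (continuous_circleMode _)).aestronglyMeasurable
    · exact Filter.Eventually.of_forall fun θ _ => by simp [norm_circleMode]
    · exact Filter.Eventually.of_forall fun _ _ => h
    · exact intervalIntegrable_const
    · refine Filter.Eventually.of_forall fun θ _ => HasSum.mul_right _ (Summable.hasSum ?_)
      exact Summable.of_norm (by simpa [norm_circleMode] using h)
  rw [fourierCoef_eq, ← hs.tsum_eq]
  refine tsum_congr fun k => ?_
  simp_rw [mul_assoc, circleMode_mul, intervalIntegral.integral_const_mul, integral_circleMode,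
    ← sub_eq_add_neg, sub_eq_zero]
  simp

theorem fourierCoef_comp_add {ψ : ℝ → ℂ} (hψ : Function.Periodic ψ 1) (α : ℝ) (n : ℤ) :
    fourierCoef (fun θ => ψ (θ + α)) n = circleMode n α * fourierCoef ψ n := by
  have hper : Function.Periodic (fun θ => ψ θ * circleMode (-n) θ) 1 :=
    hψ.mul (circleMode_periodic _)
  have hmode : ∀ θ : ℝ, circleMode (-n) θ = circleMode n α * circleMode (-n) (θ + α) := by
    intro θ
    rw [circleMode, circleMode, circleMode, ← Complex.exp_add]
    push_cast
    ring_nf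
  rw [fourierCoef_eq, fourierCoef_eq, ← intervalIntegral.integral_const_mul]
  calc ∫ θ in (0:ℝ)..1, ψ (θ + α) * circleMode (-n) θ
      = ∫ θ in (0:ℝ)..1, circleMode n α * (ψ (θ + α) * circleMode (-n) (θ + α)) := by
        refine intervalIntegral.integral_congr fun θ _ => ?_
        simp only [hmode θ]
        ring
    _ = circleMode n α * ∫ θ in α..α + 1, ψ θ * circleMode (-n) θ := by
        rw [intervalIntegral.integral_const_mul,
          intervalIntegral.integral_comp_add_right (fun θ => ψ θ * circleMode (-n) θ),
          zero_add, add_comm 1 α]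
    _ = _ := by
        rw [hper.intervalIntegral_add_eq α 0, zero_add, intervalIntegral.integral_const_mul]

theorem tendsto_fourierCoef_atTop (ψ : ℝ → ℂ) :
    Filter.Tendsto (fun n : ℕ => fourierCoef ψ n) Filter.atTop (nhds 0) := by
  have h := (Real.tendsto_integral_exp_smul_cocompact ((Ioc (0:ℝ) 1).indicator ψ)).comp
    ((tendsto_natCast_atTop_atTop (R := ℝ)).mono_right atTop_le_cocompact)
  refine h.congr fun n => ?_
  rw [fourierCoef_eq, intervalIntegral.integral_of_le zero_le_one,
    ← integral_indicator measurableSet_Ioc]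
  refine integral_congr_ae (Filter.Eventually.of_forall fun θ => ?_)
  by_cases hθ : θ ∈ Ioc (0:ℝ) 1
  · simp only [indicator_of_mem hθ, Circle.smul_def, Real.fourierChar_apply, circleMode,
      smul_eq_mul]
    rw [mul_comm]
    congr 2
    push_cast
    ring
  · simp [indicator_of_notMem hθ]

theorem summable_mul_pow_of_superpolynomial_decay {N : ℕ → ℕ} (hN : StrictMono N)
    (hN1 : ∀ k, 1 ≤ N k) {d : ℕ → ℝ} (hd0 : ∀ k, 0 ≤ d k)
    (hd : ∀ k, d k ≤ 1 / (N k : ℝ) ^ k) (r : ℕ) :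
    Summable fun k => d k * (N k : ℝ) ^ r := by
  have hs : Summable fun k : ℕ => 1 / (k : ℝ) ^ 2 :=
    Real.summable_one_div_nat_pow.mpr one_lt_two
  refine hs.of_norm_bounded_eventually_nat ?_
  filter_upwards [Filter.eventually_ge_atTop (r + 2)] with k hk
  have hk0 : (0 : ℝ) < k := by exact_mod_cast (by omega : 0 < k)
  have hNk : (1 : ℝ) ≤ N k := by exact_mod_cast hN1 k
  have hkN : (k : ℝ) ≤ N k := by exact_mod_cast hN.id_le k
  have hN0 : (0 : ℝ) < N k := by linarith
  rw [Real.norm_of_nonneg (mul_nonneg (hd0 k) (by positivity))]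
  calc d k * (N k : ℝ) ^ r ≤ 1 / (N k : ℝ) ^ k * (N k : ℝ) ^ r := by gcongr; exact hd k
    _ ≤ 1 / (N k : ℝ) ^ (r + 2) * (N k : ℝ) ^ r := by gcongr
    _ = 1 / (N k : ℝ) ^ 2 := by rw [pow_add]; field_simp
    _ ≤ 1 / (k : ℝ) ^ 2 := by gcongr

/-- if α is irrational but satisfies no Diophantine condition, there is a
smooth zero-mean function φ for which the cohomological equation has no smooth solution. -/
theorem cohomological_equation_counterexample
    (α : ℝ) (hirr : Irrational α)
    (hα : ∀ c : ℝ, 0 < c → ∀ τ : ℝ, 0 ≤ τ →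
      ∃ N : ℕ, 1 ≤ N ∧ distInt (N * α) < c / (N : ℝ) ^ (1 + τ)) :
    ∃ φ : ℝ → ℂ, SmoothPer φ ∧ (∫ θ in (0:ℝ)..1, φ θ) = 0 ∧
      ¬ ∃ ψ : ℝ → ℂ, SmoothPer ψ ∧ ∀ θ : ℝ, ψ (θ + α) - ψ θ = φ θ := by
  obtain ⟨N, hN, hN'⟩ := Filter.extraction_forall_of_frequently
    fun k : ℕ => frequently_distInt_lt hirr hα (Nat.cast_nonneg k)
  have hN1 : ∀ k, 1 ≤ N k := fun k => (hN' k).1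
  set a : ℕ → ℂ := fun k => circleMode (N k : ℤ) α - 1 with ha
  have hdist : ∀ k, distInt (N k * α) ≤ 1 / (N k : ℝ) ^ k := by
    intro k
    have hNk : (1 : ℝ) ≤ N k := by exact_mod_cast hN1 k
    refine (hN' k).2.le.trans ?_
    rw [← Real.rpow_natCast]
    gcongr
    linarith
  have hsum : ∀ r : ℕ, Summable fun k => ‖a k‖ * (2 * π * |((N k : ℤ) : ℝ)|) ^ r := by
    intro r
    refine ((summable_mul_pow_of_superpolynomial_decay hN hN1
      (fun k => (distInt_natCast_mul_pos hirr (hN1 k)).le) hdist r).mul_left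
        ((2 * π) * (2 * π) ^ r)).of_nonneg_of_le (fun k => by positivity) fun k => ?_
    have h := norm_circleMode_sub_one_le (N k : ℤ) α
    rw [Int.cast_natCast] at h
    rw [Int.cast_natCast, Nat.abs_cast, mul_pow]
    calc ‖a k‖ * ((2 * π) ^ r * (N k : ℝ) ^ r)
        ≤ (2 * π * distInt (N k * α)) * ((2 * π) ^ r * (N k : ℝ) ^ r) := by gcongr
      _ = _ := by ring
  have hsum0 : Summable fun k => ‖a k‖ := by simpa using hsum 0
  have hcoef := fourierCoef_tsum_circleMode (N := fun k => (N k : ℤ)) hsum0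
  refine ⟨_, smoothPer_tsum_circleMode hsum, ?_, ?_⟩
  · have h := hcoef 0
    have hne : ∀ k, N k ≠ 0 := fun k => Nat.one_le_iff_ne_zero.mp (hN1 k)
    simpa [fourierCoef, hne] using h
  · rintro ⟨ψ, ⟨hψ, hper⟩, heq⟩
    have hone : ∀ k, fourierCoef ψ (N k : ℤ) = 1 := by
      intro k
      have h := hcoef (N k)
      simp only [Nat.cast_inj, hN.injective.eq_iff, tsum_ite_eq] at h
      rw [← funext heq] at h
      have hsub : fourierCoef (fun θ => ψ (θ + α) - ψ θ) (N k) =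
          fourierCoef (fun θ => ψ (θ + α)) (N k) - fourierCoef ψ (N k) := by
        have hc := continuous_circleMode (-(N k : ℤ))
        have hψc := hψ.continuous
        simp only [fourierCoef_eq, sub_mul]
        exact intervalIntegral.integral_sub (Continuous.intervalIntegrable (by fun_prop) _ _)
          (Continuous.intervalIntegrable (by fun_prop) _ _)
      rw [hsub, fourierCoef_comp_add hper] at h
      have hak : a k ≠ 0 := by
        rw [ha, sub_ne_zero, Ne, circleMode_eq_one_iff]
        rintro ⟨m, hm⟩
        exact (hirr.natCast_mul (Nat.one_le_iff_ne_zero.mp (hN1 k))).ne_int m (by simpa using hm)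
      refine mul_left_cancel₀ hak ?_
      simp only [ha, mul_one] at h ⊢
      linear_combination h
    have hlim := (tendsto_fourierCoef_atTop ψ).comp hN.tendsto_atTop
    exact one_ne_zero (tendsto_nhds_unique (tendsto_const_nhds.congr fun k => (hone k).symm) hlim)
end

section
/- Let α be irrational satisfying a Diophantine condition (α ∈ CD), let β ∈ ℝ, and let h : 𝕋¹ → ℂ∖{0} be a C^∞ function of topological degree zero such that (1/2πi)∫_{𝕋¹} log h(θ) dθ ≡ β (mod 1), where log h is a continuous branch of the logarithm of h. Then there exists a C^∞ function u₁ : 𝕋¹ → ℂ∖{0}, nowhere vanishing and of topological degree zero, such that h(θ) = e^{2πiβ} · u₁(θ+α)/u₁(θ) for all θ ∈ 𝕋¹. -/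
open MeasureTheory Metric Complex Real Set Function

/-- A continuous logarithm of a smooth function is smooth. -/
theorem contDiff_of_exp_eq {h ℓ : ℝ → ℂ} {n : ℕ∞} (hh : ContDiff ℝ n h) (hℓ : Continuous ℓ)
    (hlog : ∀ θ, Complex.exp (ℓ θ) = h θ) : ContDiff ℝ n ℓ := by
  rw [contDiff_iff_contDiffAt]
  intro θ₀
  have hlocal : ℓ =ᶠ[nhds θ₀] fun θ => ℓ θ₀ + Complex.log (h θ * (h θ₀)⁻¹) := by
    have hev : ∀ᶠ θ in nhds θ₀, |(ℓ θ - ℓ θ₀).im| < π := by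
      refine ContinuousAt.eventually_lt (by fun_prop) continuousAt_const ?_
      simpa using Real.pi_pos
    filter_upwards [hev] with θ hθ
    rw [← hlog, ← hlog, ← Complex.exp_neg, ← Complex.exp_add, ← sub_eq_add_neg,
      Complex.log_exp (abs_lt.mp hθ).1 (abs_lt.mp hθ).2.le]
    ring
  refine ContDiffAt.congr_of_eventuallyEq (contDiffAt_const.add ?_) hlocal
  have hne : h θ₀ ≠ 0 := hlog θ₀ ▸ Complex.exp_ne_zero _
  have hlg : ContDiffAt ℝ n Complex.log (h θ₀ * (h θ₀)⁻¹) := by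
    rw [mul_inv_cancel₀ hne]
    exact (Complex.contDiffAt_log Complex.one_mem_slitPlane).restrict_scalars ℝ
  exact hlg.comp θ₀ (hh.contDiffAt.mul contDiffAt_const)

theorem iteratedDeriv_const_mul_cexp (k : ℕ) (a c : ℂ) :
    iteratedDeriv k (fun θ : ℝ => a * Complex.exp (c * θ)) =
      fun θ : ℝ => a * c ^ k * Complex.exp (c * θ) := by
  induction k with
  | zero => simp
  | succ k ih =>
    rw [iteratedDeriv_succ, ih]
    funext θ
    have h1 : HasDerivAt (fun θ : ℝ => c * (θ : ℂ)) (c * 1) θ :=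
      (Complex.ofRealCLM.hasDerivAt (x := θ)).const_mul c
    rw [(h1.cexp.const_mul (a * c ^ k)).deriv]
    ring

theorem norm_cexp_two_pi_mul (n : ℤ) (θ : ℝ) : ‖Complex.exp (2 * π * I * n * θ)‖ = 1 := by
  have : (2 * π * I * n * θ : ℂ) = ((2 * π * n * θ : ℝ) : ℂ) * I := by push_cast; ring
  rw [this, Complex.norm_exp_ofReal_mul_I]

/-- A trigonometric series with rapidly decreasing coefficients is smooth. -/
theorem contDiff_tsum_cexp {a : ℤ → ℂ} (ha : ∀ k : ℕ, Summable fun n : ℤ => ‖a n‖ * |(n : ℝ)| ^ k) :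
    ContDiff ℝ (⊤ : ℕ∞) fun θ : ℝ => ∑' n : ℤ, a n * Complex.exp (2 * π * I * n * θ) := by
  refine contDiff_tsum (v := fun k n => (2 * π) ^ k * (‖a n‖ * |(n : ℝ)| ^ k)) (fun n => ?_)
    (fun k _ => (ha k).mul_left _) (fun k n θ _ => ?_)
  · exact contDiff_const.mul ((contDiff_const.mul Complex.ofRealCLM.contDiff).cexp)
  · rw [norm_iteratedFDeriv_eq_norm_iteratedDeriv, iteratedDeriv_const_mul_cexp]
    simp only [norm_mul, norm_pow, norm_cexp_two_pi_mul]
    simp [abs_of_pos Real.pi_pos, mul_pow]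
    apply le_of_eq
    ring

theorem fourierCoef_deriv {φ : ℝ → ℂ} (hφ : ContDiff ℝ 1 φ) (hp : Periodic φ 1) (n : ℤ) :
    fourierCoef (deriv φ) n = 2 * π * I * n * fourierCoef φ n := by
  have hder : ∀ x : ℝ, HasDerivAt (fun θ : ℝ => Complex.exp (-(2 * π * I * n * θ)))
      (-(2 * π * I * n) * Complex.exp (-(2 * π * I * n * x))) x := fun x => by
    have h1 : HasDerivAt (fun θ : ℝ => -(2 * π * I * n * (θ : ℂ))) (-(2 * π * I * n * 1)) x :=
      ((Complex.ofRealCLM.hasDerivAt (x := x)).const_mul (2 * π * I * n)).neg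
    convert h1.cexp using 1
    ring
  have hend : Complex.exp (-(2 * π * I * n * (1 : ℝ))) = 1 := by
    rw [Complex.exp_eq_one_iff]
    exact ⟨-n, by push_cast; ring⟩
  have hφ01 : φ 1 = φ 0 := by simpa using hp 0
  have key := intervalIntegral.integral_deriv_mul_eq_sub (a := 0) (b := 1)
    (u := φ) (u' := deriv φ) (fun x _ => (hφ.differentiable one_ne_zero x).hasDerivAt)
    (fun x _ => hder x) ((hφ.continuous_deriv le_rfl).intervalIntegrable _ _)
    (Continuous.intervalIntegrable (by fun_prop) _ _)
  have hdc := hφ.continuous_deriv le_rfl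
  have hc := hφ.continuous
  rw [intervalIntegral.integral_add (Continuous.intervalIntegrable (by fun_prop) _ _)
    (Continuous.intervalIntegrable (by fun_prop) _ _), hend, hφ01] at key
  simp only [fourierCoef]
  have h2 : (∫ x in (0:ℝ)..1, φ x * (-(2 * π * I * n) * Complex.exp (-(2 * π * I * n * x)))) =
      -(2 * π * I * n) * ∫ x in (0:ℝ)..1, φ x * Complex.exp (-(2 * π * I * n * x)) := by
    rw [← intervalIntegral.integral_const_mul]
    congr 1 with x
    ring
  rw [h2] at key
  simp only [Complex.ofReal_zero, mul_zero, neg_zero, Complex.exp_zero, sub_self] at key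
  linear_combination key

theorem exists_norm_fourierCoef_le {φ : ℝ → ℂ} (hφ : Continuous φ) :
    ∃ C, ∀ n : ℤ, ‖fourierCoef φ n‖ ≤ C := by
  obtain ⟨C, hC⟩ := isCompact_Icc.exists_bound_of_continuousOn (s := Icc (0:ℝ) 1) hφ.continuousOn
  refine ⟨C, fun n => ?_⟩
  have := intervalIntegral.norm_integral_le_of_norm_le_const (a := 0) (b := 1) (C := C)
    (f := fun θ : ℝ => φ θ * Complex.exp (-(2 * π * I * n * θ))) fun x hx => by
      have h1 := norm_cexp_two_pi_mul (-n) x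
      push_cast at h1
      rw [norm_mul, show (-(2 * π * I * n * x) : ℂ) = 2 * π * I * -n * x by ring, h1, mul_one]
      exact hC x (Ioc_subset_Icc_self (by simpa using hx))
  simpa [fourierCoef] using this

/-- The Fourier coefficients of a smooth periodic function decrease rapidly. -/
theorem exists_norm_fourierCoef_mul_pow_le {φ : ℝ → ℂ} (hφ : SmoothPer φ) (k : ℕ) :
    ∃ C, ∀ n : ℤ, ‖fourierCoef φ n‖ * |(n : ℝ)| ^ k ≤ C := by
  induction k generalizing φ with
  | zero => simpa using exists_norm_fourierCoef_le hφ.1.continuous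
  | succ k ih =>
    obtain ⟨C, hC⟩ := ih (φ := deriv φ) ⟨(contDiff_infty_iff_deriv.mp hφ.1).2, fun x => by
      rw [← deriv_comp_add_const, funext hφ.2]⟩
    refine ⟨C, fun n => le_trans ?_ (hC n)⟩
    rw [fourierCoef_deriv (hφ.1.of_le (by exact_mod_cast le_top)) hφ.2]
    have h2 : 1 ≤ 2 * π := by linarith [Real.pi_gt_three]
    have h3 : 0 ≤ ‖fourierCoef φ n‖ * |(n : ℝ)| ^ (k + 1) := by positivity
    simp only [norm_mul, Complex.norm_ofNat, Complex.norm_real, Complex.norm_I, Complex.norm_intCast,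
      Real.norm_eq_abs, abs_of_pos Real.pi_pos]
    calc _ ≤ 2 * π * (‖fourierCoef φ n‖ * |(n : ℝ)| ^ (k + 1)) := le_mul_of_one_le_left h3 h2
      _ = _ := by ring

theorem summable_norm_fourierCoef_mul_pow {φ : ℝ → ℂ} (hφ : SmoothPer φ) (k : ℕ) :
    Summable fun n : ℤ => ‖fourierCoef φ n‖ * |(n : ℝ)| ^ k := by
  obtain ⟨C, hC⟩ := exists_norm_fourierCoef_mul_pow_le hφ (k + 2)
  have hs : Summable fun n : ℤ => C * (1 / (n : ℝ) ^ 2) :=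
    (Real.summable_one_div_int_pow.mpr one_lt_two).mul_left C
  refine hs.of_norm_bounded_eventually ?_
  filter_upwards [(finite_singleton (0 : ℤ)).compl_mem_cofinite] with n hn
  have hn0 : (n : ℝ) ≠ 0 := by exact_mod_cast hn
  rw [Real.norm_of_nonneg (by positivity), mul_one_div, le_div_iff₀ (by positivity), ← sq_abs,
    mul_assoc, ← pow_add]
  exact hC n

/-- A smooth periodic function is the sum of its Fourier series. -/
theorem hasSum_fourierCoef {φ : ℝ → ℂ} (hφ : SmoothPer φ) (θ : ℝ) :
    HasSum (fun n : ℤ => fourierCoef φ n * Complex.exp (2 * π * I * n * θ)) (φ θ) := by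
  let F : C(AddCircle (1 : ℝ), ℂ) :=
    ⟨hφ.2.lift, continuous_coinduced_dom.mpr hφ.1.continuous⟩
  have hF : fourierCoeff F = fourierCoef φ := by
    funext n
    rw [fourierCoeff_eq_intervalIntegral _ _ 0]
    simp only [fourierCoef, zero_add, div_one, one_smul]
    refine intervalIntegral.integral_congr fun x _ => ?_
    change fourier (-n) (x : AddCircle (1 : ℝ)) • φ x = _
    rw [fourier_coe_apply, smul_eq_mul, mul_comm]
    congr 2
    push_cast
    ring
  have hs : Summable (fourierCoeff F) := by
    rw [hF]
    exact Summable.of_norm (by simpa using summable_norm_fourierCoef_mul_pow hφ 0)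
  have := has_pointwise_sum_fourier_series_of_summable hs (θ : AddCircle (1 : ℝ))
  rw [hF] at this
  simpa only [fourier_coe_apply, Complex.ofReal_one, div_one, smul_eq_mul] using! this

theorem two_mul_distInt_le_abs_sin (x : ℝ) : 2 * distInt x ≤ |Real.sin (π * x)| := by
  have h1 : distInt x ≤ |x - round x| :=
    ciInf_le ⟨0, by rintro _ ⟨p, rfl⟩; exact abs_nonneg _⟩ (round x)
  have h2 : |π * (x - round x)| ≤ π / 2 := by
    rw [abs_mul, abs_of_pos Real.pi_pos]
    nlinarith [abs_sub_round x, Real.pi_pos]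
  have h3 := Real.mul_abs_le_abs_sin h2
  have h4 : |Real.sin (π * (x - round x))| = |Real.sin (π * x)| := by
    rw [show π * (x - round x) = π * x - round x * π by ring, Real.sin_sub_int_mul_pi, abs_mul]
    simp
  rw [h4, abs_mul, abs_of_pos Real.pi_pos, ← mul_assoc, div_mul_cancel₀ _ Real.pi_ne_zero] at h3
  linarith

theorem norm_cexp_two_pi_mul_sub_one (n : ℤ) (α : ℝ) :
    ‖Complex.exp (2 * π * I * n * α) - 1‖ = 2 * |Real.sin (π * (n.natAbs * α))| := by
  have h1 : (2 * π * I * n * α : ℂ) = I * ((2 * π * n * α : ℝ) : ℂ) := by push_cast; ring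
  rw [h1, Complex.norm_exp_I_mul_ofReal_sub_one, Real.norm_eq_abs, abs_mul, abs_two]
  congr 1
  rw [show 2 * π * n * α / 2 = π * (n * α) by ring]
  rcases Int.natAbs_eq n with h | h
  · have hn : (n : ℝ) = n.natAbs := by rw [← Int.cast_natCast, ← h]
    rw [hn]
  · have hn : (n : ℝ) = -n.natAbs := by exact_mod_cast h
    rw [hn, neg_mul, mul_neg, Real.sin_neg, abs_neg]

/-- Polynomial lower bound on the small divisors of a Diophantine rotation. -/
theorem IsCD.exists_le_norm_cexp_sub_one {α : ℝ} (hα : IsCD α) :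
    ∃ c : ℝ, 0 < c ∧ ∃ K : ℕ, ∀ n : ℤ, n ≠ 0 →
      c ≤ |(n : ℝ)| ^ K * ‖Complex.exp (2 * π * I * n * α) - 1‖ := by
  obtain ⟨-, c, hc, τ, hτ, h⟩ := hα
  refine ⟨c, hc, ⌈1 + τ⌉₊, fun n hn => ?_⟩
  have hN : 1 ≤ n.natAbs := Int.natAbs_pos.mpr hn
  have hN' : (1 : ℝ) ≤ n.natAbs := by exact_mod_cast hN
  have h1 := h _ hN
  rw [div_le_iff₀ (by positivity)] at h1
  have habs : |(n : ℝ)| = n.natAbs := by rw [Nat.cast_natAbs, Int.cast_abs]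
  have h2 : (n.natAbs : ℝ) ^ (1 + τ) ≤ (n.natAbs : ℝ) ^ ⌈1 + τ⌉₊ := by
    rw [← Real.rpow_natCast]
    exact Real.rpow_le_rpow_of_exponent_le hN' (Nat.le_ceil _)
  have h3 := two_mul_distInt_le_abs_sin (n.natAbs * α)
  have h4 : 0 ≤ distInt (n.natAbs * α) := Real.iInf_nonneg fun _ => abs_nonneg _
  rw [norm_cexp_two_pi_mul_sub_one, habs, mul_comm]
  refine h1.trans (mul_le_mul (by linarith) h2 (by positivity) (by positivity))

/-- Over a Diophantine rotation, every smooth periodic function is, up to its mean, a smooth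
coboundary. -/
theorem IsCD.exists_smooth_coboundary {α : ℝ} (hα : IsCD α) {φ : ℝ → ℂ} (hφ : SmoothPer φ) :
    ∃ L : ℝ → ℂ, SmoothPer L ∧ ∀ θ, L (θ + α) - L θ = φ θ - ∫ x in (0:ℝ)..1, φ x := by
  obtain ⟨c, hc, K, hK⟩ := hα.exists_le_norm_cexp_sub_one
  set e : ℤ → ℂ := fun n => Complex.exp (2 * π * I * n * α) - 1 with he
  have he0 : ∀ n : ℤ, n ≠ 0 → e n ≠ 0 := fun n hn h0 => by
    have := hK n hn
    rw [show Complex.exp (2 * π * I * n * α) - 1 = 0 from h0] at this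
    simp only [norm_zero, mul_zero] at this
    linarith
  set a : ℤ → ℂ := fun n => fourierCoef φ n / e n with ha
  have hdecay : ∀ k : ℕ, Summable fun n : ℤ => ‖a n‖ * |(n : ℝ)| ^ k := fun k => by
    refine ((summable_norm_fourierCoef_mul_pow hφ (k + K)).mul_left c⁻¹).of_nonneg_of_le
      (fun n => by positivity) fun n => ?_
    rcases eq_or_ne n 0 with rfl | hn
    · have : a 0 = 0 := by simp [ha, he]
      rw [this, norm_zero, zero_mul]
      positivity
    · have hpos : 0 < ‖e n‖ := norm_pos_iff.mpr (he0 n hn)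
      rw [ha, norm_div, inv_mul_eq_div, div_mul_eq_mul_div, div_le_div_iff₀ hpos hc, pow_add]
      have := mul_le_mul_of_nonneg_left (hK n hn)
        (show 0 ≤ ‖fourierCoef φ n‖ * |(n : ℝ)| ^ k by positivity)
      calc _ ≤ _ := this
        _ = _ := by ring
  have hsum : ∀ θ : ℝ, Summable fun n : ℤ => a n * Complex.exp (2 * π * I * n * θ) := fun θ =>
    Summable.of_norm (by simpa [norm_cexp_two_pi_mul] using hdecay 0)
  refine ⟨fun θ => ∑' n : ℤ, a n * Complex.exp (2 * π * I * n * θ),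
    ⟨contDiff_tsum_cexp hdecay, fun θ => ?_⟩, fun θ => ?_⟩
  · refine tsum_congr fun n => ?_
    congr 1
    rw [Complex.exp_eq_exp_iff_exists_int]
    exact ⟨n, by push_cast; ring⟩
  · have hmean : fourierCoef φ 0 = ∫ x in (0:ℝ)..1, φ x := by simp [fourierCoef]
    have h1 := (hasSum_fourierCoef hφ θ).sub (hasSum_ite_eq (0 : ℤ) (fourierCoef φ 0))
    rw [← hmean, ← h1.tsum_eq, ← (hsum _).tsum_sub (hsum _)]
    refine tsum_congr fun n => ?_
    rw [Complex.ofReal_add, mul_add, Complex.exp_add]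
    split_ifs with hn
    · simp [hn]
    · have hd : a n * e n = fourierCoef φ n := div_mul_cancel₀ _ (he0 n hn)
      rw [← hd, he]
      ring

/-- solvability of the normal-form cohomological equation. If α ∈ CD and
h : 𝕋¹ → ℂ∖{0} is smooth, of degree zero (it admits a continuous logarithm ℓ), with
(1/2πi)∫ℓ ≡ β (mod 1), then h(θ) = e^{2πiβ}·u₁(θ+α)/u₁(θ) for some smooth nowhere-vanishing
u₁ of degree zero. -/
theorem normal_form_cohomological_equation
    (α β : ℝ) (hα : IsCD α)
    (h : ℝ → ℂ) (hsm : SmoothPer h) (hne : ∀ θ, h θ ≠ 0)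
    (ℓ : ℝ → ℂ) (hℓc : Continuous ℓ) (hℓp : Function.Periodic ℓ 1)
    (hlog : ∀ θ, Complex.exp (ℓ θ) = h θ)
    (hrot : ∃ m : ℤ, (∫ θ in (0:ℝ)..1, ℓ θ) = 2 * π * I * (β + m)) :
    ∃ u₁ : ℝ → ℂ, SmoothPer u₁ ∧ (∀ θ, u₁ θ ≠ 0) ∧
      (∃ L : ℝ → ℂ, Continuous L ∧ Function.Periodic L 1 ∧ ∀ θ, Complex.exp (L θ) = u₁ θ) ∧
      ∀ θ : ℝ, h θ = Complex.exp (2 * π * I * β) * u₁ (θ + α) / u₁ θ := by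
  obtain ⟨m, hm⟩ := hrot
  obtain ⟨L, hL, hcob⟩ := hα.exists_smooth_coboundary ⟨contDiff_of_exp_eq hsm.1 hℓc hlog, hℓp⟩
  refine ⟨fun θ => Complex.exp (L θ), ⟨hL.1.cexp, fun θ => by simp only [hL.2 θ]⟩,
    fun θ => Complex.exp_ne_zero _, ⟨L, hL.1.continuous, hL.2, fun θ => rfl⟩, fun θ => ?_⟩
  have h1 := hcob θ
  rw [hm] at h1
  rw [← hlog, ← Complex.exp_add, ← Complex.exp_sub, Complex.exp_eq_exp_iff_exists_int]
  exact ⟨m, by linear_combination -h1⟩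
end
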